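/- Along any B₀ T²-symmetric Einstein flow, at every time τ one has | (Π_τ/Π) E − ∫_{S¹} e^{ρ−2τ} ρ_τ J dθ | ≲ E ∫_{S¹} e^{ρ−τ} ρ_τ J dθ. -/

import Mathlib

noncomputable section

open Real MeasureTheory intervalIntegral

/-- The θ-mean of a function on the circle of circumference 1 (total measure 1). -/
def circleMean (f : ℝ → ℝ) : ℝ := ∫ θ in (0:ℝ)..1, f θ

/-- The smooth, θ-periodic fields `V, Q, ρ, l` of a T²-symmetric spacetime in areal
coordinates; first argument is `τ`, second is `θ`. -/
structure T2Flow where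
  V : ℝ → ℝ → ℝ
  Q : ℝ → ℝ → ℝ
  ρ : ℝ → ℝ → ℝ
  l : ℝ → ℝ → ℝ
  smooth_V : ContDiff ℝ (⊤ : ℕ∞) (Function.uncurry V)
  smooth_Q : ContDiff ℝ (⊤ : ℕ∞) (Function.uncurry Q)
  smooth_ρ : ContDiff ℝ (⊤ : ℕ∞) (Function.uncurry ρ)
  smooth_l : ContDiff ℝ (⊤ : ℕ∞) (Function.uncurry l)
  periodic_V : ∀ τ, Function.Periodic (V τ) 1
  periodic_Q : ∀ τ, Function.Periodic (Q τ) 1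
  periodic_ρ : ∀ τ, Function.Periodic (ρ τ) 1
  periodic_l : ∀ τ, Function.Periodic (l τ) 1

namespace T2Flow

/-- `V_τ`. -/
def Vτ (F : T2Flow) (τ θ : ℝ) : ℝ := deriv (fun s => F.V s θ) τ
/-- `V_θ`. -/
def Vθ (F : T2Flow) (τ θ : ℝ) : ℝ := deriv (fun x => F.V τ x) θ
/-- `Q_τ`. -/
def Qτ (F : T2Flow) (τ θ : ℝ) : ℝ := deriv (fun s => F.Q s θ) τ
/-- `Q_θ`. -/
def Qθ (F : T2Flow) (τ θ : ℝ) : ℝ := deriv (fun x => F.Q τ x) θ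
/-- `ρ_τ`. -/
def ρτ (F : T2Flow) (τ θ : ℝ) : ℝ := deriv (fun s => F.ρ s θ) τ
/-- `l_τ`. -/
def lτ (F : T2Flow) (τ θ : ℝ) : ℝ := deriv (fun s => F.l s θ) τ
/-- `l_θ`. -/
def lθ (F : T2Flow) (τ θ : ℝ) : ℝ := deriv (fun x => F.l τ x) θ

/-- The energy density
`J = (1/2)[V_τ² + e^{2(τ−ρ)}V_θ² + e^{2(V−τ)}(Q_τ² + e^{2(τ−ρ)}Q_θ²)]`. -/
def J (F : T2Flow) (τ θ : ℝ) : ℝ :=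
  (1/2) * (F.Vτ τ θ ^ 2 + exp (2*(τ - F.ρ τ θ)) * F.Vθ τ θ ^ 2
    + exp (2*(F.V τ θ - τ)) * (F.Qτ τ θ ^ 2 + exp (2*(τ - F.ρ τ θ)) * F.Qθ τ θ ^ 2))

/-- The T²-symmetric vacuum Einstein evolution equations together with the
momentum constraint. -/
def IsEinsteinFlow (F : T2Flow) : Prop :=
  (∀ τ θ : ℝ, deriv (fun s => exp (F.ρ s θ) * F.Vτ s θ) τ
      = deriv (fun x => exp (2*τ - F.ρ τ x) * F.Vθ τ x) θ
        + exp (2*(F.V τ θ - τ) + F.ρ τ θ)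
          * (F.Qτ τ θ ^ 2 - exp (2*(τ - F.ρ τ θ)) * F.Qθ τ θ ^ 2)) ∧
  (∀ τ θ : ℝ, deriv (fun s => exp (F.ρ s θ + 2*(F.V s θ - s)) * F.Qτ s θ) τ
      = deriv (fun x => exp (-F.ρ τ x + 2*F.V τ x) * F.Qθ τ x) θ) ∧
  (∀ τ θ : ℝ, F.lτ τ θ + F.ρτ τ θ + 2 = F.J τ θ) ∧
  (∀ τ θ : ℝ, F.ρτ τ θ = exp (F.l τ θ)) ∧
  (∀ τ θ : ℝ, F.lθ τ θ = F.Vθ τ θ * F.Vτ τ θ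
      + exp (2*(F.V τ θ - τ)) * F.Qθ τ θ * F.Qτ τ θ)

/-- The conserved quantity `A = ∫ e^ρ (V_τ − e^{2(V−τ)} Q_τ Q) dθ`. -/
def A (F : T2Flow) (τ : ℝ) : ℝ :=
  ∫ θ in (0:ℝ)..1,
    exp (F.ρ τ θ) * (F.Vτ τ θ - exp (2*(F.V τ θ - τ)) * F.Qτ τ θ * F.Q τ θ)

/-- The conserved quantity `B = ∫ e^{ρ+2(V−τ)} Q_τ dθ`. -/
def B (F : T2Flow) (τ : ℝ) : ℝ :=
  ∫ θ in (0:ℝ)..1, exp (F.ρ τ θ + 2*(F.V τ θ - τ)) * F.Qτ τ θ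

/-- The energy `E = ∫ e^{ρ−2τ} J dθ`. -/
def E (F : T2Flow) (τ : ℝ) : ℝ := ∫ θ in (0:ℝ)..1, exp (F.ρ τ θ - 2*τ) * F.J τ θ

/-- The `S¹`-volume `Π = ⟨e^ρ⟩`. -/
def Pi (F : T2Flow) (τ : ℝ) : ℝ := ∫ θ in (0:ℝ)..1, exp (F.ρ τ θ)

/-- The correction `Λ = (1/2) e^{−2τ} ∫ V_τ (V − ⟨V⟩ − 1) e^ρ dθ`. -/
def Λ (F : T2Flow) (τ : ℝ) : ℝ :=
  (1/2) * exp (-2*τ) *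
    ∫ θ in (0:ℝ)..1, F.Vτ τ θ * (F.V τ θ - circleMean (F.V τ) - 1) * exp (F.ρ τ θ)

/-- The corrected, normalized energy `H = Π (E + Λ)`. -/
def H (F : T2Flow) (τ : ℝ) : ℝ := F.Pi τ * (F.E τ + F.Λ τ)

/-- The twist potential `Y = ⟨e^{l+ρ+2τ}⟩`. -/
def Y (F : T2Flow) (τ : ℝ) : ℝ := ∫ θ in (0:ℝ)..1, exp (F.l τ θ + F.ρ τ θ + 2*τ)

/-- The error term `Ω = ⟨e^{l+ρ+2τ} J⟩ − e^{2τ} E Y Π⁻¹`. -/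
def Ω (F : T2Flow) (τ : ℝ) : ℝ :=
  (∫ θ in (0:ℝ)..1, exp (F.l τ θ + F.ρ τ θ + 2*τ) * F.J τ θ)
    - exp (2*τ) * F.E τ * F.Y τ / F.Pi τ

end T2Flow

/-! ### Calculus on smooth functions of two real variables -/

lemma hasDerivAt_slice_left {f : ℝ → ℝ → ℝ} (hf : ContDiff ℝ (⊤ : ℕ∞) (Function.uncurry f))
    (s x : ℝ) :
    HasDerivAt (fun s => f s x) (fderiv ℝ (Function.uncurry f) (s, x) (1, 0)) s :=
  (hf.differentiable (by simp) (s, x)).hasFDerivAt.comp_hasDerivAt (f := fun s => (s, x)) s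
    ((hasDerivAt_id s).prodMk (hasDerivAt_const s x))

lemma hasDerivAt_slice_right {f : ℝ → ℝ → ℝ} (hf : ContDiff ℝ (⊤ : ℕ∞) (Function.uncurry f))
    (s x : ℝ) :
    HasDerivAt (fun x => f s x) (fderiv ℝ (Function.uncurry f) (s, x) (0, 1)) x :=
  (hf.differentiable (by simp) (s, x)).hasFDerivAt.comp_hasDerivAt (f := fun x => (s, x)) x
    ((hasDerivAt_const x s).prodMk (hasDerivAt_id x))

lemma continuous_fderiv_slice {f : ℝ → ℝ → ℝ} (hf : ContDiff ℝ (⊤ : ℕ∞) (Function.uncurry f))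
    (v : ℝ × ℝ) : Continuous fun p : ℝ × ℝ => fderiv ℝ (Function.uncurry f) p v :=
  (hf.continuous_fderiv (by simp)).clm_apply continuous_const

lemma continuous_deriv_slice_left {f : ℝ → ℝ → ℝ}
    (hf : ContDiff ℝ (⊤ : ℕ∞) (Function.uncurry f)) :
    Continuous fun p : ℝ × ℝ => deriv (fun s => f s p.2) p.1 := by
  simpa only [(hasDerivAt_slice_left hf _ _).deriv] using continuous_fderiv_slice hf (1, 0)

lemma continuous_deriv_slice_right {f : ℝ → ℝ → ℝ}
    (hf : ContDiff ℝ (⊤ : ℕ∞) (Function.uncurry f)) :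
    Continuous fun p : ℝ × ℝ => deriv (fun x => f p.1 x) p.2 := by
  simpa only [(hasDerivAt_slice_right hf _ _).deriv] using continuous_fderiv_slice hf (0, 1)

/-- Differentiation under the integral sign over a compact interval. -/
lemma hasDerivAt_intervalIntegral_of_continuous {f f' : ℝ → ℝ → ℝ} {a b : ℝ}
    (hf : Continuous (Function.uncurry f)) (hf' : Continuous (Function.uncurry f'))
    (h : ∀ s x, HasDerivAt (fun s => f s x) (f' s x) s) (τ : ℝ) :
    HasDerivAt (fun s => ∫ x in a..b, f s x) (∫ x in a..b, f' τ x) τ := by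
  obtain ⟨C, hC⟩ := ((isCompact_closedBall τ 1).prod (isCompact_uIcc (a := a) (b := b)))
    |>.exists_bound_of_continuousOn hf'.continuousOn
  refine (intervalIntegral.hasDerivAt_integral_of_dominated_loc_of_deriv_le (bound := fun _ => C)
    (Metric.closedBall_mem_nhds τ one_pos) (.of_forall fun s => ?_) ?_ ?_ ?_ ?_ ?_).2
  · exact (hf.comp (Continuous.prodMk_right s)).aestronglyMeasurable
  · exact (hf.comp (Continuous.prodMk_right τ)).intervalIntegrable _ _
  · exact (hf'.comp (Continuous.prodMk_right τ)).aestronglyMeasurable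
  · exact .of_forall fun x hx s hs => hC (s, x) ⟨hs, Set.uIoc_subset_uIcc hx⟩
  · exact intervalIntegrable_const
  · exact .of_forall fun x _ s _ => h s x

/-- A function oscillates on `[a, b]` by at most the integral of a bound for its
derivative. -/
lemma abs_sub_le_integral_of_abs_deriv_le {g g' k : ℝ → ℝ} {a b x y : ℝ}
    (hg : ∀ z, HasDerivAt g (g' z) z) (hg' : Continuous g') (hk : Continuous k)
    (hgk : ∀ z, |g' z| ≤ k z) (hx : x ∈ Set.Icc a b) (hy : y ∈ Set.Icc a b) :
    |g x - g y| ≤ ∫ z in a..b, k z := by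
  wlog hyx : y ≤ x generalizing x y
  · rw [abs_sub_comm]
    exact this hy hx (le_of_not_ge hyx)
  rw [← integral_eq_sub_of_hasDerivAt (fun z _ => hg z) (hg'.intervalIntegrable _ _)]
  calc |∫ z in y..x, g' z| ≤ ∫ z in y..x, |g' z| := abs_integral_le_integral_abs hyx
    _ ≤ ∫ z in y..x, k z := integral_mono hyx (hg'.abs.intervalIntegrable _ _)
        (hk.intervalIntegrable _ _) hgk
    _ ≤ ∫ z in a..b, k z := integral_mono_interval hy.1 hyx hx.2
        (.of_forall fun z => (abs_nonneg _).trans (hgk z)) (hk.intervalIntegrable _ _)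

/-- If `w ≥ 0` and `|g - m| ≤ K` on `[a, b]`, then `m ∫ w` and `∫ w g` differ by at most
`K ∫ w`. -/
lemma abs_mul_integral_sub_integral_mul_le {w g : ℝ → ℝ} {a b m K : ℝ} (hab : a ≤ b)
    (hw : Continuous w) (hg : Continuous g) (hw0 : ∀ x, 0 ≤ w x)
    (hK : ∀ x ∈ Set.Icc a b, |m - g x| ≤ K) :
    |m * (∫ x in a..b, w x) - ∫ x in a..b, w x * g x| ≤ K * ∫ x in a..b, w x := by
  have hi : ∀ {f : ℝ → ℝ}, Continuous f → IntervalIntegrable f volume a b :=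
    fun hf => hf.intervalIntegrable _ _
  rw [← intervalIntegral.integral_const_mul,
    ← intervalIntegral.integral_sub (hi (by fun_prop)) (hi (by fun_prop)),
    ← intervalIntegral.integral_const_mul]
  refine (abs_integral_le_integral_abs hab).trans
    (integral_mono_on hab (hi (by fun_prop)) (hi (by fun_prop)) fun x hx => ?_)
  rw [mul_comm (w x), ← sub_mul, abs_mul, abs_of_nonneg (hw0 x)]
  exact mul_le_mul_of_nonneg_right (hK x hx) (hw0 x)

/-- A weighted mean of `g` over `[a, b]` differs from any value of `g` by at most the
oscillation of `g`. -/
lemma abs_weighted_mean_sub_le {p g : ℝ → ℝ} {a b y K : ℝ} (hab : a < b)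
    (hp : Continuous p) (hg : Continuous g) (hp0 : ∀ x, 0 < p x)
    (hK : ∀ x ∈ Set.Icc a b, |g y - g x| ≤ K) :
    |(∫ x in a..b, p x * g x) / (∫ x in a..b, p x) - g y| ≤ K := by
  have hpos : 0 < ∫ x in a..b, p x :=
    intervalIntegral_pos_of_pos (hp.intervalIntegrable _ _) hp0 hab
  have h := abs_mul_integral_sub_integral_mul_le hab.le hp hg (fun x => (hp0 x).le) hK
  rw [abs_sub_comm] at h
  rwa [div_sub' hpos.ne', abs_div, abs_of_pos hpos, div_le_iff₀ hpos, mul_comm _ (g y)]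

namespace T2Flow

variable (F : T2Flow)

lemma continuous_J (τ : ℝ) : Continuous (F.J τ) := by
  have slice {f : ℝ × ℝ → ℝ} (hf : Continuous f) : Continuous fun x => f (τ, x) :=
    hf.comp (Continuous.prodMk_right τ)
  have h1 : Continuous (F.Vτ τ) := slice (continuous_deriv_slice_left F.smooth_V)
  have h2 : Continuous (F.Vθ τ) := slice (continuous_deriv_slice_right F.smooth_V)
  have h3 : Continuous (F.Qτ τ) := slice (continuous_deriv_slice_left F.smooth_Q)
  have h4 : Continuous (F.Qθ τ) := slice (continuous_deriv_slice_right F.smooth_Q)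
  have h5 : Continuous (F.V τ) := slice F.smooth_V.continuous
  have h6 : Continuous (F.ρ τ) := slice F.smooth_ρ.continuous
  unfold J
  fun_prop

lemma J_nonneg (τ θ : ℝ) : 0 ≤ F.J τ θ := by
  unfold J
  positivity

lemma hasDerivAt_Pi (τ : ℝ) :
    HasDerivAt F.Pi (∫ θ in (0:ℝ)..1, exp (F.ρ τ θ) * F.ρτ τ θ) τ := by
  refine hasDerivAt_intervalIntegral_of_continuous
    (f := fun τ θ => exp (F.ρ τ θ)) (f' := fun τ θ => exp (F.ρ τ θ) * F.ρτ τ θ)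
    ?_ ?_ (fun s x => ?_) τ
  · exact continuous_exp.comp F.smooth_ρ.continuous
  · exact (continuous_exp.comp F.smooth_ρ.continuous).mul
      (continuous_deriv_slice_left F.smooth_ρ)
  · exact (hasDerivAt_slice_left F.smooth_ρ s x).differentiableAt.hasDerivAt.exp

/-- The momentum density is controlled by the energy density. -/
lemma abs_momentum_le (τ θ : ℝ) :
    |F.Vθ τ θ * F.Vτ τ θ + exp (2*(F.V τ θ - τ)) * F.Qθ τ θ * F.Qτ τ θ|
      ≤ exp (F.ρ τ θ - τ) * F.J τ θ := by
  have he : exp (2*(τ - F.ρ τ θ)) = exp (τ - F.ρ τ θ) ^ 2 := by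
    rw [← exp_nat_mul]
    norm_num
  have hc : exp (F.ρ τ θ - τ) * exp (τ - F.ρ τ θ) = 1 := by
    rw [← exp_add]
    simp
  have hd := (exp_pos (F.ρ τ θ - τ)).le
  have hq := (exp_pos (2*(F.V τ θ - τ))).le
  unfold J
  rw [he]
  generalize exp (τ - F.ρ τ θ) = c at *
  generalize exp (F.ρ τ θ - τ) = d at *
  generalize exp (2*(F.V τ θ - τ)) = q at *
  generalize F.Vτ τ θ = W
  generalize F.Vθ τ θ = U
  generalize F.Qτ τ θ = R
  generalize F.Qθ τ θ = S
  have h1 : 0 ≤ d / 2 * ((W + c * U) ^ 2 + q * (R + c * S) ^ 2) := by positivity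
  have h2 : 0 ≤ d / 2 * ((W - c * U) ^ 2 + q * (R - c * S) ^ 2) := by positivity
  rw [abs_le]
  constructor
  · linear_combination h1 + (U * W + q * S * R) * hc
  · linear_combination h2 - (U * W + q * S * R) * hc

variable {F}

lemma IsEinsteinFlow.abs_ρτ_sub_le (hF : F.IsEinsteinFlow) (τ : ℝ) {x y : ℝ}
    (hx : x ∈ Set.Icc (0:ℝ) 1) (hy : y ∈ Set.Icc (0:ℝ) 1) :
    |F.ρτ τ x - F.ρτ τ y| ≤ ∫ θ in (0:ℝ)..1, exp (F.ρ τ θ - τ) * F.ρτ τ θ * F.J τ θ := by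
  obtain ⟨-, -, -, hρ, hl⟩ := hF
  have hc (f : ℝ → ℝ → ℝ) (hf : ContDiff ℝ (⊤ : ℕ∞) (Function.uncurry f)) : Continuous (f τ) :=
    hf.continuous.comp (Continuous.prodMk_right τ)
  have hcρ := hc F.ρ F.smooth_ρ
  have hcl := hc F.l F.smooth_l
  have hcJ := F.continuous_J τ
  have hcθ : Continuous (F.lθ τ) :=
    (continuous_deriv_slice_right F.smooth_l).comp (Continuous.prodMk_right τ)
  simp only [hρ]
  refine abs_sub_le_integral_of_abs_deriv_le (g := fun θ => exp (F.l τ θ))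
    (g' := fun θ => exp (F.l τ θ) * F.lθ τ θ)
    (fun z => (hasDerivAt_slice_right F.smooth_l τ z).differentiableAt.hasDerivAt.exp)
    (by fun_prop) (by fun_prop) (fun z => ?_) hx hy
  rw [abs_mul, abs_of_pos (exp_pos _), hl, mul_comm (exp (F.ρ τ z - τ)),
    mul_assoc (exp (F.l τ z))]
  exact mul_le_mul_of_nonneg_left (F.abs_momentum_le τ z) (exp_pos _).le

end T2Flow

/-- For `B₀` solutions,
`|(Π_τ/Π)E − ∫ e^{ρ−2τ} ρ_τ J dθ| ≲ E ∫ e^{ρ−τ} ρ_τ J dθ`. -/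
theorem j_error_bound :
    ∃ C : ℝ, 0 < C ∧ ∀ (F : T2Flow), F.IsEinsteinFlow → (∀ τ : ℝ, F.B τ = 0) →
      ∀ τ : ℝ,
        |deriv F.Pi τ / F.Pi τ * F.E τ
            - ∫ θ in (0:ℝ)..1, Real.exp (F.ρ τ θ - 2*τ) * F.ρτ τ θ * F.J τ θ|
          ≤ C * (F.E τ * ∫ θ in (0:ℝ)..1, Real.exp (F.ρ τ θ - τ) * F.ρτ τ θ * F.J τ θ) := by
  refine ⟨1, one_pos, fun F hF _ τ => ?_⟩
  have slice {f : ℝ × ℝ → ℝ} (hf : Continuous f) : Continuous fun x => f (τ, x) :=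
    hf.comp (Continuous.prodMk_right τ)
  have hρ : Continuous (F.ρ τ) := slice F.smooth_ρ.continuous
  have hρτ : Continuous (F.ρτ τ) := slice (continuous_deriv_slice_left F.smooth_ρ)
  have hJ := F.continuous_J τ
  have hmean : ∀ y ∈ Set.Icc (0:ℝ) 1, |deriv F.Pi τ / F.Pi τ - F.ρτ τ y|
      ≤ ∫ θ in (0:ℝ)..1, exp (F.ρ τ θ - τ) * F.ρτ τ θ * F.J τ θ := fun y hy => by
    rw [(F.hasDerivAt_Pi τ).deriv]
    exact abs_weighted_mean_sub_le one_pos (by fun_prop) hρτ (fun _ => exp_pos _)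
      fun x hx => hF.abs_ρτ_sub_le τ hy hx
  have h := abs_mul_integral_sub_integral_mul_le (w := fun θ => exp (F.ρ τ θ - 2*τ) * F.J τ θ)
    zero_le_one (by fun_prop) hρτ
    (fun θ => mul_nonneg (exp_pos _).le (F.J_nonneg τ θ)) hmean
  simp only [mul_right_comm _ (F.J τ _)] at h
  rwa [one_mul, mul_comm (F.E τ)]
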